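/- arXiv:2106.11244 — 2 statements merged into one kernel-verified Lean document; each statement's English description precedes it below -/
import Mathlib

section
/- Let α be a real constant with 0 < α < 1. Then the limit as n → ∞ of |Λ_n(⌊αn⌋) \ Π_n(⌊αn⌋)| / n! exists, is at most 1/2, and for α = 1/2 the limit of |Λ_n(⌊n/2⌋) \ Π_n(⌊n/2⌋)| / n! equals exactly 1/2. (Equivalently, the success probability of the stopping rule τ_n(α) satisfies lim_{n→∞} P_{n,τ}(α) ≤ lim_{n→∞} P_{n,τ}(1/2) = 1/2.) -/
open Finset

namespace Secretary

/-- Relative rank of `x` with regard to `P`: the number of `z ∈ P` with `z ≤ x`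
(as an integer, so that differences can be computed in `ℤ`). -/
def rr {n : ℕ} (P : Finset (Fin n)) (x : Fin n) : ℤ :=
  ((P.filter fun z => z ≤ x).card : ℤ)

/-- `Δ(k) = {-1, 1, k-1, 1-k} ⊆ ℤ`. -/
def Δ (k : ℕ) : Finset ℤ := {-1, 1, (k : ℤ) - 1, 1 - (k : ℤ)}

/-- `{x, y} ∈ Adj(P)`: both belong to `P` and the difference of their relative
ranks with regard to `P` (in one of the two orders) lies in `Δ(|P|)`. -/
def Adj {n : ℕ} (P : Finset (Fin n)) (x y : Fin n) : Prop :=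
  x ∈ P ∧ y ∈ P ∧ (rr P x - rr P y ∈ Δ P.card ∨ rr P y - rr P x ∈ Δ P.card)

instance {n : ℕ} (P : Finset (Fin n)) (x y : Fin n) : Decidable (Adj P x y) := by
  unfold Adj; infer_instance

/-- `Ω n`: the sequences of `n` distinct applicants (as injective, hence
bijective, functions `Fin n → Fin n`); `|Ω n| = n!`. -/
def Ω (n : ℕ) : Finset (Fin n → Fin n) :=
  Finset.univ.filter Function.Injective

/-- The `i`-th applicant of the sequence `x`, with the 1-based indexing
`x_1, …, x_n` of the paper. -/
def get {n : ℕ} [NeZero n] (x : Fin n → Fin n) (i : ℕ) : Fin n :=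
  x ⟨(i - 1) % n, Nat.mod_lt _ (Nat.pos_of_ne_zero (NeZero.ne n))⟩

/-- The set `{x_1, …, x_i}` of the first `i` applicants of the sequence `x`. -/
def pre {n : ℕ} (x : Fin n → Fin n) (i : ℕ) : Finset (Fin n) :=
  (Finset.univ.filter fun j : Fin n => (j : ℕ) < i).image x

/-- `Λ_n(r,k)`: sequences `x ∈ Ω_n` with `{x_k, x_{k+1}} ∈ Adj(C_n)` and
`{x_{i-1}, x_i} ∉ Adj({x_1,…,x_i})` for all `i ∈ {r,…,k}`. -/
def Lam : (n : ℕ) → ℕ → ℕ → Finset (Fin n → Fin n)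
  | 0, _, _ => ∅
  | (m + 1), r, k =>
      (Ω (m + 1)).filter fun x =>
        Adj Finset.univ (get x k) (get x (k + 1)) ∧
          ∀ i, i ≤ k → r ≤ i → ¬ Adj (pre x i) (get x (i - 1)) (get x i)

/-- `Λ_n(r) = ⋃_{k=r}^{n-1} Λ_n(r,k)`. -/
def LamU (n : ℕ) (r : ℕ) : Finset (Fin n → Fin n) :=
  (Finset.Icc r (n - 1)).biUnion fun k => Lam n r k

/-- `Π_n(r)`: those `x ∈ Λ_n(r)` such that for the (unique) `k` with
`x ∈ Λ_n(r,k)` one has `rr_n(x_k) - rr_n(x_{k+1}) ∈ {1-n, n-1}`. -/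
def Pi' : (n : ℕ) → ℕ → Finset (Fin n → Fin n)
  | 0, _ => ∅
  | (m + 1), r =>
      (LamU (m + 1) r).filter fun x =>
        ∃ k ∈ Finset.Icc r m, x ∈ Lam (m + 1) r k ∧
          rr Finset.univ (get x k) - rr Finset.univ (get x (k + 1)) ∈
            ({1 - ((m : ℤ) + 1), ((m : ℤ) + 1) - 1} : Finset ℤ)

/-- `Λ_n(r,k,z,z̄)`: sequences of `Λ_n(r,k)` with `x_k = z` and `x_{k+1} = z̄`. -/
def Lam4 : (n : ℕ) → ℕ → ℕ → Fin n → Fin n → Finset (Fin n → Fin n)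
  | 0, _, _, z, _ => z.elim0
  | (m + 1), r, k, z, w =>
      (Lam (m + 1) r k).filter fun x => get x k = z ∧ get x (k + 1) = w

lemma rr_univ {n : ℕ} (a : Fin n) : rr Finset.univ a = (a : ℤ) + 1 := by
  have h : (Finset.univ.filter fun z : Fin n => z ≤ a) = Finset.Iic a := by
    ext; simp
  simp [rr, h]

lemma rr_image {m n : ℕ} {f : Fin m → Fin n} (hf : StrictMono f) (P : Finset (Fin m))
    (a : Fin m) : rr (P.image f) (f a) = rr P a := by
  have h : (P.image f).filter (fun z => z ≤ f a) = (P.filter fun z => z ≤ a).image f := by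
    rw [Finset.filter_image]
    simp [hf.le_iff_le]
  rw [rr, rr, h, Finset.card_image_of_injective _ hf.injective]

lemma adj_image {m n : ℕ} {f : Fin m → Fin n} (hf : StrictMono f) (P : Finset (Fin m))
    (a b : Fin m) : Adj (P.image f) (f a) (f b) ↔ Adj P a b := by
  simp only [Adj, rr_image hf, Finset.card_image_of_injective _ hf.injective,
    hf.injective.mem_finset_image]

/-- Neighbours in the linear order of `Fin n`. -/
def LinAdj {n : ℕ} (a b : Fin n) : Prop := (a : ℕ) + 1 = b ∨ (b : ℕ) + 1 = a

instance {n : ℕ} (a b : Fin n) : Decidable (LinAdj a b) := by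
  unfold LinAdj; infer_instance

/-- The first and the last element of `Fin n`. -/
def Extreme {n : ℕ} (a : Fin n) : Prop := (a : ℕ) = 0 ∨ (a : ℕ) + 1 = n

instance {n : ℕ} (a : Fin n) : Decidable (Extreme a) := by
  unfold Extreme; infer_instance

lemma adj_univ {n : ℕ} (a b : Fin n) :
    Adj Finset.univ a b ↔ LinAdj a b ∨ (a : ℕ) + 1 = b + n ∨ (b : ℕ) + 1 = a + n := by
  simp only [Adj, rr_univ, Δ, LinAdj, Finset.mem_univ, Finset.card_univ, Fintype.card_fin,
    Finset.mem_insert, Finset.mem_singleton, true_and]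
  omega

/-- No two consecutive applicants up to time `k` are adjacent on arrival, from time `r` on. -/
def NonAdj {n : ℕ} [NeZero n] (r k : ℕ) (x : Fin n → Fin n) : Prop :=
  ∀ i, i ≤ k → r ≤ i → ¬ Adj (pre x i) (get x (i - 1)) (get x i)

instance {n : ℕ} [NeZero n] (r k : ℕ) (x : Fin n → Fin n) : Decidable (NonAdj r k x) := by
  unfold NonAdj; infer_instance

lemma nonAdj_succ {n : ℕ} [NeZero n] {r k : ℕ} (h : r ≤ k + 1) (x : Fin n → Fin n) :
    NonAdj r (k + 1) x ↔
      NonAdj r k x ∧ ¬ Adj (pre x (k + 1)) (get x k) (get x (k + 1)) := by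
  refine ⟨fun H => ⟨fun i hi => H i (by omega), H (k + 1) le_rfl h⟩, fun H i hi hr => ?_⟩
  rcases hi.lt_or_eq with hi | rfl
  · exact H.1 i (by omega) hr
  · exact H.2

/-- Append an applicant of rank `v` to a sequence, keeping the relative order of the others. -/
def insertLast {m : ℕ} (v : Fin (m + 1)) (x : Fin m → Fin m) : Fin (m + 1) → Fin (m + 1) :=
  Fin.snoc (α := fun _ => Fin (m + 1)) (fun i => v.succAbove (x i)) v

lemma insertLast_castSucc {m : ℕ} (v : Fin (m + 1)) (x : Fin m → Fin m) (i : Fin m) :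
    insertLast v x i.castSucc = v.succAbove (x i) := by
  simp [insertLast]

lemma insertLast_last {m : ℕ} (v : Fin (m + 1)) (x : Fin m → Fin m) :
    insertLast v x (Fin.last m) = v := by
  simp [insertLast]

lemma get_insertLast_of_le {m : ℕ} [NeZero m] (v : Fin (m + 1)) (x : Fin m → Fin m) {i : ℕ}
    (hi : i ≤ m) : get (insertLast v x) i = v.succAbove (get x i) := by
  have hm : 0 < m := Nat.pos_of_ne_zero (NeZero.ne m)
  rw [get, get, ← insertLast_castSucc]
  congr 1
  ext
  simp only [Fin.val_castSucc]
  rw [Nat.mod_eq_of_lt (by omega), Nat.mod_eq_of_lt (by omega)]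

lemma get_insertLast_succ {m : ℕ} (v : Fin (m + 1)) (x : Fin m → Fin m) :
    get (insertLast v x) (m + 1) = v := by
  rw [get]
  conv_rhs => rw [← insertLast_last v x]
  congr 1
  ext
  simp

lemma pre_insertLast {m : ℕ} (v : Fin (m + 1)) (x : Fin m → Fin m) {i : ℕ} (hi : i ≤ m) :
    pre (insertLast v x) i = (pre x i).image v.succAbove := by
  ext y
  simp only [pre, Finset.mem_image, Finset.mem_filter, Finset.mem_univ, true_and]
  constructor
  · rintro ⟨j, hj, rfl⟩
    refine ⟨_, ⟨⟨j, by omega⟩, hj, rfl⟩, ?_⟩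
    rw [← insertLast_castSucc]
    rfl
  · rintro ⟨_, ⟨j, hj, rfl⟩, rfl⟩
    exact ⟨j.castSucc, hj, insertLast_castSucc _ _ _⟩

lemma nonAdj_insertLast {m : ℕ} [NeZero m] {r k : ℕ} (hk : k ≤ m) (v : Fin (m + 1))
    (x : Fin m → Fin m) : NonAdj r k (insertLast v x) ↔ NonAdj r k x := by
  unfold NonAdj
  refine forall_congr' fun i => forall_congr' fun hi => forall_congr' fun _ => ?_
  rw [pre_insertLast v x (by omega), get_insertLast_of_le v x (by omega),
    get_insertLast_of_le v x (by omega), adj_image (Fin.strictMono_succAbove v)]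

lemma insertLast_injective {m : ℕ} {v w : Fin (m + 1)} {x y : Fin m → Fin m}
    (h : insertLast v x = insertLast w y) : v = w ∧ x = y := by
  have hv : v = w := by rw [← insertLast_last v x, h, insertLast_last]
  subst hv
  refine ⟨rfl, funext fun i => Fin.succAbove_right_injective (p := v) ?_⟩
  rw [← insertLast_castSucc, h, insertLast_castSucc]

lemma insertLast_mem_Ω {m : ℕ} {v : Fin (m + 1)} {x : Fin m → Fin m} (hx : x ∈ Ω m) :
    insertLast v x ∈ Ω (m + 1) := by
  simp only [Ω, Finset.mem_filter, Finset.mem_univ, true_and] at hx ⊢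
  intro i j
  induction i using Fin.lastCases <;> induction j using Fin.lastCases <;>
    simp [insertLast_castSucc, insertLast_last, Fin.succAbove_ne, hx.eq_iff,
      Fin.ne_succAbove]

lemma exists_insertLast {m : ℕ} {y : Fin (m + 1) → Fin (m + 1)} (hy : y ∈ Ω (m + 1)) :
    ∃ v, ∃ x ∈ Ω m, insertLast v x = y := by
  simp only [Ω, Finset.mem_filter, Finset.mem_univ, true_and] at hy ⊢
  have h : ∀ i : Fin m, ∃ z, (y (Fin.last m)).succAbove z = y i.castSucc := fun i =>
    Fin.exists_succAbove_eq fun h => (Fin.castSucc_lt_last i).ne (hy h)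
  choose x hx using h
  refine ⟨y (Fin.last m), x, fun i j hij => ?_, ?_⟩
  · exact Fin.castSucc_injective m (hy (by rw [← hx, ← hx, hij]))
  · funext i
    induction i using Fin.lastCases <;> simp [insertLast_castSucc, insertLast_last, hx]

lemma card_filter_Ω_succ {m : ℕ} (p : (Fin (m + 1) → Fin (m + 1)) → Prop) [DecidablePred p] :
    ((Ω (m + 1)).filter p).card =
      ∑ x ∈ Ω m, (Finset.univ.filter fun v => p (insertLast v x)).card := by
  rw [← Finset.card_sigma]
  symm
  refine Finset.card_bij (fun a _ => insertLast a.2 a.1) ?_ ?_ ?_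
  · rintro ⟨x, v⟩ h
    simp only [Finset.mem_sigma, Finset.mem_filter, Finset.mem_univ, true_and] at h ⊢
    exact ⟨insertLast_mem_Ω h.1, h.2⟩
  · rintro ⟨x, v⟩ _ ⟨y, w⟩ _ h
    obtain ⟨rfl, rfl⟩ := insertLast_injective h
    rfl
  · intro y hy
    rw [Finset.mem_filter] at hy
    obtain ⟨v, x, hx, rfl⟩ := exists_insertLast hy.1
    exact ⟨⟨x, v⟩, by simp [hx, hy.2], rfl⟩

lemma card_Ω (n : ℕ) : (Ω n).card = n.factorial := by
  induction n with
  | zero => simp [Ω, Function.injective_of_subsingleton]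
  | succ m ih =>
    have h := card_filter_Ω_succ (m := m) fun _ => True
    simp only [Finset.filter_true, Finset.sum_const, Finset.card_univ, Fintype.card_fin,
      smul_eq_mul, ih] at h
    rw [h, Nat.factorial_succ, mul_comm]

lemma pre_self {n : ℕ} {x : Fin n → Fin n} (hx : x ∈ Ω n) : pre x n = Finset.univ := by
  simp only [Ω, Finset.mem_filter, Finset.mem_univ, true_and] at hx
  simp only [pre, Fin.is_lt, Finset.filter_true]
  exact Finset.image_univ_of_surjective (Finite.surjective_of_injective hx)

lemma val_succAbove {m : ℕ} (v : Fin (m + 1)) (c : Fin m) :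
    ((v.succAbove c : Fin (m + 1)) : ℕ) = if (c : ℕ) < v then (c : ℕ) else c + 1 := by
  rw [Fin.succAbove]
  simp only [Fin.lt_def, Fin.val_castSucc]
  split_ifs <;> simp

lemma linAdj_succAbove_self {m : ℕ} (v : Fin (m + 1)) (c : Fin m) :
    LinAdj (v.succAbove c) v ↔ v = c.castSucc ∨ v = c.succ := by
  simp only [LinAdj, val_succAbove, Fin.ext_iff, Fin.val_castSucc, Fin.val_succ]
  split_ifs <;> omega

lemma card_linAdj_succAbove_self {m : ℕ} (c : Fin m) :
    (Finset.univ.filter fun v : Fin (m + 1) => LinAdj (v.succAbove c) v).card = 2 := by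
  have h : (Finset.univ.filter fun v : Fin (m + 1) => LinAdj (v.succAbove c) v) =
      {c.castSucc, c.succ} := by
    ext v; simp [linAdj_succAbove_self]
  rw [h, Finset.card_pair]
  simp [Fin.ext_iff]

lemma card_linAdj_succAbove {m : ℕ} (a b : Fin m) :
    (Finset.univ.filter fun v : Fin (m + 1) => LinAdj (v.succAbove a) (v.succAbove b)).card =
      if LinAdj a b then m else 0 := by
  split_ifs with h
  · have : (Finset.univ.filter fun v : Fin (m + 1) =>
        LinAdj (v.succAbove a) (v.succAbove b)) = Finset.univ.erase (max a b).castSucc := by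
      ext v
      simp only [LinAdj, Finset.mem_filter, Finset.mem_univ, true_and, Finset.mem_erase,
        val_succAbove, Fin.ext_iff, Fin.val_castSucc, Fin.coe_max, and_true, ne_eq] at h ⊢
      split_ifs <;> omega
    simp [this]
  · rw [Finset.card_eq_zero, Finset.filter_eq_empty_iff]
    intro v _
    simp only [LinAdj, val_succAbove] at h ⊢
    split_ifs <;> omega

lemma card_not_adj_succAbove {m : ℕ} (hm : 3 ≤ m) (c : Fin m) :
    (Finset.univ.filter fun v : Fin (m + 1) =>
      ¬ Adj Finset.univ (v.succAbove c) v).card + (if Extreme c then 1 else 0) = m - 1 := by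
  have key := Finset.card_filter_add_card_filter_not (s := (Finset.univ : Finset (Fin (m + 1))))
    (fun v => Adj Finset.univ (v.succAbove c) v)
  have h : (Finset.univ.filter fun v : Fin (m + 1) => Adj Finset.univ (v.succAbove c) v) =
      {c.castSucc, c.succ} ∪ (if (c : ℕ) = 0 then {Fin.last m} else ∅) ∪
        (if (c : ℕ) + 1 = m then {0} else ∅) := by
    ext v
    have := v.is_lt
    have := c.is_lt
    simp only [Finset.mem_filter, Finset.mem_univ, true_and, Finset.mem_union]
    simp only [adj_univ, linAdj_succAbove_self, Finset.mem_insert, Finset.mem_singleton,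
      val_succAbove, Fin.ext_iff, Fin.val_castSucc, Fin.val_succ]
    split_ifs <;>
      simp only [Finset.mem_singleton, Finset.notMem_empty, Fin.ext_iff, Fin.val_last,
        Fin.val_zero, or_false] <;> omega
  have h2 : (Finset.univ.filter fun v : Fin (m + 1) =>
      Adj Finset.univ (v.succAbove c) v).card = 2 + if Extreme c then 1 else 0 := by
    have := c.is_lt
    rw [h]
    have h3 : ({c.castSucc, c.succ} : Finset (Fin (m + 1))).card = 2 :=
      Finset.card_pair (by simp [Fin.ext_iff])
    by_cases h0 : (c : ℕ) = 0
    · have h1 : ¬ (c : ℕ) + 1 = m := by omega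
      rw [if_pos h0, if_neg h1, if_pos (show Extreme c from Or.inl h0), Finset.union_empty,
        Finset.card_union_of_disjoint, h3, Finset.card_singleton]
      simp only [Finset.disjoint_singleton_right, Finset.mem_insert, Finset.mem_singleton,
        Fin.ext_iff, Fin.val_last, Fin.val_castSucc, Fin.val_succ]
      omega
    · rw [if_neg h0, Finset.union_empty]
      by_cases h1 : (c : ℕ) + 1 = m
      · rw [if_pos h1, if_pos (show Extreme c from Or.inr h1), Finset.card_union_of_disjoint, h3,
          Finset.card_singleton]
        simp only [Finset.disjoint_singleton_right, Finset.mem_insert, Finset.mem_singleton,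
          Fin.ext_iff, Fin.val_zero, Fin.val_castSucc, Fin.val_succ]
        omega
      · rw [if_neg h1, if_neg (show ¬ Extreme c from not_or.2 ⟨h0, h1⟩), Finset.union_empty, h3]
  rw [h2, Finset.card_univ, Fintype.card_fin] at key
  omega

lemma card_extreme {m : ℕ} (hm : 1 ≤ m) :
    (Finset.univ.filter fun v : Fin (m + 1) => Extreme v).card = 2 := by
  have h : (Finset.univ.filter fun v : Fin (m + 1) => Extreme v) = {0, Fin.last m} := by
    ext v
    simp only [Finset.mem_filter, Finset.mem_univ, true_and]
    simp only [Extreme, Finset.mem_insert, Finset.mem_singleton, Fin.ext_iff, Fin.val_zero,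
      Fin.val_last]
    omega
  rw [h, Finset.card_pair]
  simp only [ne_eq, Fin.ext_iff, Fin.val_zero, Fin.val_last]
  omega

lemma card_extreme_not_adj {m : ℕ} (hm : 3 ≤ m) (c : Fin m) :
    (Finset.univ.filter fun v : Fin (m + 1) =>
      ¬ Adj Finset.univ (v.succAbove c) v ∧ Extreme v).card + (if Extreme c then 2 else 0) =
      2 := by
  have := c.is_lt
  split_ifs with h
  · rw [Nat.add_eq_right, Finset.card_eq_zero, Finset.filter_eq_empty_iff]
    intro v _
    have := v.is_lt
    simp only [adj_univ, linAdj_succAbove_self, Extreme, val_succAbove, Fin.ext_iff,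
      Fin.val_castSucc, Fin.val_succ] at h ⊢
    split_ifs <;> omega
  · rw [add_zero, ← card_extreme (m := m) (by omega)]
    congr 1
    ext v
    have := v.is_lt
    simp only [Finset.mem_filter, Finset.mem_univ, true_and]
    simp only [adj_univ, linAdj_succAbove_self, Extreme, val_succAbove, Fin.ext_iff,
      Fin.val_castSucc, Fin.val_succ] at h ⊢
    split_ifs <;> omega

/-- The sequences of length `m` without adjacency on arrival from time `r` on. -/
def nonAdjSet (m : ℕ) [NeZero m] (r : ℕ) : Finset (Fin m → Fin m) :=
  (Ω m).filter (NonAdj r m)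

/-- The sequences in `nonAdjSet m r` whose last applicant is extreme. -/
def nonAdjExtremeSet (m : ℕ) [NeZero m] (r : ℕ) : Finset (Fin m → Fin m) :=
  (nonAdjSet m r).filter fun x => Extreme (get x m)

/-- The sequences of `Lam n r k` whose `k`-th and `k+1`-st applicants are linear neighbours. -/
def linSet (n : ℕ) [NeZero n] (r k : ℕ) : Finset (Fin n → Fin n) :=
  (Ω n).filter fun x => NonAdj r k x ∧ LinAdj (get x k) (get x (k + 1))

lemma nonAdj_insertLast_succ {m : ℕ} [NeZero m] {r : ℕ} (hr : r ≤ m + 1) (v : Fin (m + 1))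
    {x : Fin m → Fin m} (hx : x ∈ Ω m) :
    NonAdj r (m + 1) (insertLast v x) ↔
      NonAdj r m x ∧ ¬ Adj Finset.univ (v.succAbove (get x m)) v := by
  rw [nonAdj_succ hr, nonAdj_insertLast le_rfl, pre_self (insertLast_mem_Ω hx),
    get_insertLast_succ, get_insertLast_of_le _ _ le_rfl]

lemma card_nonAdjSet_succ {m : ℕ} [NeZero m] {r : ℕ} (hm : 3 ≤ m) (hr : r ≤ m + 1) :
    (nonAdjSet (m + 1) r).card + (nonAdjExtremeSet m r).card =
      (m - 1) * (nonAdjSet m r).card := by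
  rw [nonAdjSet, card_filter_Ω_succ, nonAdjExtremeSet, Finset.card_filter, nonAdjSet,
    Finset.sum_filter, ← Finset.sum_add_distrib, mul_comm, ← smul_eq_mul, ← Finset.sum_const,
    Finset.sum_filter]
  refine Finset.sum_congr rfl fun x hx => ?_
  simp only [nonAdj_insertLast_succ hr _ hx]
  by_cases h : NonAdj r m x
  · simpa [h] using card_not_adj_succAbove hm (get x m)
  · simp [h]

lemma card_nonAdjExtremeSet_succ {m : ℕ} [NeZero m] {r : ℕ} (hm : 3 ≤ m) (hr : r ≤ m + 1) :
    (nonAdjExtremeSet (m + 1) r).card + 2 * (nonAdjExtremeSet m r).card =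
      2 * (nonAdjSet m r).card := by
  rw [nonAdjExtremeSet, nonAdjSet, Finset.filter_filter, card_filter_Ω_succ, nonAdjExtremeSet,
    Finset.card_filter, nonAdjSet, Finset.sum_filter, Finset.mul_sum, ← Finset.sum_add_distrib,
    mul_comm, ← smul_eq_mul, ← Finset.sum_const, Finset.sum_filter]
  refine Finset.sum_congr rfl fun x hx => ?_
  simp only [nonAdj_insertLast_succ hr _ hx, get_insertLast_succ]
  by_cases h : NonAdj r m x
  · simpa [h] using card_extreme_not_adj hm (get x m)
  · simp [h]

lemma card_linSet_self {m : ℕ} [NeZero m] (r : ℕ) :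
    (linSet (m + 1) r m).card = 2 * (nonAdjSet m r).card := by
  rw [linSet, card_filter_Ω_succ, nonAdjSet, mul_comm, ← smul_eq_mul, ← Finset.sum_const,
    Finset.sum_filter]
  refine Finset.sum_congr rfl fun x hx => ?_
  simp only [nonAdj_insertLast le_rfl, get_insertLast_succ, get_insertLast_of_le _ _ le_rfl]
  by_cases h : NonAdj r m x
  · simpa [h] using card_linAdj_succAbove_self (get x m)
  · simp [h]

lemma card_linSet_succ {n : ℕ} [NeZero n] (r : ℕ) {k : ℕ} (hk : k + 1 ≤ n) :
    (linSet (n + 1) r k).card = n * (linSet n r k).card := by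
  rw [linSet, card_filter_Ω_succ, linSet, mul_comm, ← smul_eq_mul, ← Finset.sum_const,
    Finset.sum_filter]
  refine Finset.sum_congr rfl fun x hx => ?_
  have hk' : k ≤ n := by omega
  simp only [nonAdj_insertLast hk', get_insertLast_of_le _ _ hk, get_insertLast_of_le _ _ hk']
  by_cases h : NonAdj r k x
  · simpa [h] using card_linAdj_succAbove (get x k) (get x (k + 1))
  · simp [h]

lemma nonAdjSet_of_lt {m : ℕ} [NeZero m] {r : ℕ} (h : m < r) : nonAdjSet m r = Ω m := by
  rw [nonAdjSet, Finset.filter_true_of_mem]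
  intro x _ i hi hr
  omega

lemma card_nonAdjExtremeSet_of_lt {m r : ℕ} (hm : 1 ≤ m) (h : m + 1 < r) :
    (nonAdjExtremeSet (m + 1) r).card = 2 * m.factorial := by
  rw [nonAdjExtremeSet, nonAdjSet_of_lt h, card_filter_Ω_succ]
  simp [get_insertLast_succ, card_extreme hm, card_Ω, mul_comm]

lemma card_nonAdjSet_aux (r : ℕ) {m : ℕ} (hm : r + 2 ≤ m) :
    (m + 1) * (nonAdjExtremeSet (m + 1) (r + 4)).card = 2 * (nonAdjSet (m + 1) (r + 4)).card ∧
      (nonAdjSet (m + 1) (r + 4)).card * (m * (m - 1 : ℝ)) =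
        (m + 1).factorial * ((r + 2) * (r + 1)) := by
  induction m, hm using Nat.le_induction with
  | base =>
    rw [nonAdjSet_of_lt (by omega), card_nonAdjExtremeSet_of_lt (by omega) (by omega), card_Ω,
      Nat.factorial_succ (r + 2)]
    push_cast
    constructor <;> ring
  | succ m hm ih =>
    obtain ⟨h1, h2⟩ := ih
    have e1 := card_nonAdjSet_succ (m := m + 1) (r := r + 4) (by omega) (by omega)
    have e2 := card_nonAdjExtremeSet_succ (m := m + 1) (r := r + 4) (by omega) (by omega)
    rw [Nat.factorial_succ (m + 1)]
    rw [Nat.add_sub_cancel] at e1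
    rify at h1 e1 e2 ⊢
    have hk : (m : ℝ) + 1 ≠ 0 := by positivity
    have hE : ((nonAdjExtremeSet (m + 1) (r + 4)).card : ℝ) =
        2 * (nonAdjSet (m + 1) (r + 4)).card / (m + 1) := by
      field_simp; linarith
    rw [mul_assoc, ← h2, eq_sub_of_add_eq e2, eq_sub_of_add_eq e1, hE]
    constructor <;> field_simp <;> ring

lemma card_nonAdjSet {r m : ℕ} (hr : 4 ≤ r) (hm : r ≤ m + 2) :
    ((nonAdjSet (m + 1) r).card : ℝ) / (m + 1).factorial =
      ((r : ℝ) - 2) * (r - 3) * (1 / ((m : ℝ) - 1) - 1 / m) := by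
  obtain ⟨s, rfl⟩ := Nat.exists_eq_add_of_le' hr
  have h := (card_nonAdjSet_aux s (m := m) (by omega)).2
  have h3 : ((m + 1).factorial : ℝ) ≠ 0 := by positivity
  have h2 : (2 : ℝ) ≤ m := by exact_mod_cast (by omega : 2 ≤ m)
  have h1 : (m : ℝ) - 1 ≠ 0 := by linarith
  have h0 : (m : ℝ) ≠ 0 := by linarith
  push_cast
  field_simp
  linear_combination h

lemma card_linSet {m r k : ℕ} [NeZero k] (hk : k ≤ m) :
    ((linSet (m + 1) r k).card : ℝ) / (m + 1).factorial =
      2 / ((m : ℝ) + 1) * (((nonAdjSet k r).card : ℝ) / k.factorial) := by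
  have h : (linSet (m + 1) r k).card * k.factorial =
      m.factorial * (2 * (nonAdjSet k r).card) := by
    induction m, hk using Nat.le_induction with
    | base => rw [card_linSet_self, mul_comm]
    | succ m hm ih =>
      rw [card_linSet_succ r (by omega), mul_assoc, ih, Nat.factorial_succ, mul_assoc]
  have h' : ((linSet (m + 1) r k).card : ℝ) * k.factorial =
      m.factorial * (2 * (nonAdjSet k r).card) := by exact_mod_cast h
  have h1 : (k.factorial : ℝ) ≠ 0 := by positivity
  have h2 : (m.factorial : ℝ) ≠ 0 := by positivity
  rw [Nat.factorial_succ]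
  push_cast
  field_simp
  linear_combination h'

lemma Adj.symm {n : ℕ} {P : Finset (Fin n)} {a b : Fin n} (h : Adj P a b) : Adj P b a :=
  ⟨h.2.1, h.1, h.2.2.symm⟩

lemma Adj.of_univ {n : ℕ} {P : Finset (Fin n)} {a b : Fin n} (h : Adj Finset.univ a b)
    (ha : a ∈ P) (hb : b ∈ P) : Adj P a b := by
  wlog hab : (a : ℕ) + 1 = b ∨ (b : ℕ) + 1 = a + n generalizing a b
  · refine (this h.symm hb ha ?_).symm
    have := adj_univ a b |>.1 h
    unfold LinAdj at this
    omega
  refine ⟨ha, hb, Or.inr ?_⟩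
  rcases hab with hab | hab
  · have : P.filter (fun z => z ≤ b) = insert b (P.filter fun z => z ≤ a) := by
      ext z
      simp only [Finset.mem_filter, Finset.mem_insert, Fin.le_def]
      constructor
      · rintro ⟨hz, hzb⟩
        by_cases e : z = b
        · exact Or.inl e
        · rw [Fin.ext_iff] at e
          exact Or.inr ⟨hz, by omega⟩
      · rintro (rfl | ⟨hz, hza⟩)
        · exact ⟨hb, le_rfl⟩
        · exact ⟨hz, by omega⟩
    rw [rr, rr, this, Finset.card_insert_of_notMem]
    · simp [Δ]
    · simp only [Finset.mem_filter, Fin.le_def, not_and]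
      omega
  · have h1 : P.filter (fun z => z ≤ a) = {a} := by
      ext z
      simp only [Finset.mem_filter, Finset.mem_singleton, Fin.le_def]
      constructor
      · rintro ⟨_, hz⟩
        ext
        omega
      · rintro rfl
        exact ⟨ha, le_rfl⟩
    have h2 : P.filter (fun z => z ≤ b) = P := by
      refine Finset.filter_true_of_mem fun z _ => ?_
      have := z.is_lt
      simp only [Fin.le_def]
      omega
    simp [rr, h1, h2, Δ]

lemma get_mem_pre {n : ℕ} [NeZero n] (x : Fin n → Fin n) {i j : ℕ} (hi : i - 1 < j) :
    get x i ∈ pre x j :=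
  Finset.mem_image_of_mem _ (by simpa using (Nat.mod_le _ _).trans_lt hi)

lemma mem_Lam {m r k : ℕ} {x : Fin (m + 1) → Fin (m + 1)} :
    x ∈ Lam (m + 1) r k ↔
      x ∈ Ω (m + 1) ∧ Adj Finset.univ (get x k) (get x (k + 1)) ∧ NonAdj r k x := by
  simp [Lam, NonAdj]

lemma Lam_unique {m r k l : ℕ} (hk : r ≤ k) (hl : r ≤ l) {x : Fin (m + 1) → Fin (m + 1)}
    (hxk : x ∈ Lam (m + 1) r k) (hxl : x ∈ Lam (m + 1) r l) : k = l := by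
  wlog h : k < l generalizing k l
  · rcases Nat.lt_or_eq_of_le (not_lt.1 h) with h | h
    · exact (this hl hk hxl hxk h).symm
    · exact h.symm
  rw [mem_Lam] at hxk hxl
  exact absurd (hxk.2.1.of_univ (get_mem_pre x (by omega)) (get_mem_pre x (by omega)))
    (hxl.2.2 (k + 1) h (by omega))

lemma linSet_subset_Lam {m r k : ℕ} : linSet (m + 1) r k ⊆ Lam (m + 1) r k := by
  intro x hx
  rw [linSet, Finset.mem_filter] at hx
  exact mem_Lam.2 ⟨hx.1, (adj_univ _ _).2 (Or.inl hx.2.2), hx.2.1⟩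

lemma LamU_sdiff_Pi' {m r : ℕ} (hm : 2 ≤ m) :
    LamU (m + 1) r \ Pi' (m + 1) r = (Finset.Icc r m).biUnion fun k => linSet (m + 1) r k := by
  ext x
  simp only [Pi', Finset.mem_sdiff, Finset.mem_filter, Finset.mem_biUnion, LamU,
    Nat.add_sub_cancel, rr_univ, Finset.mem_insert, Finset.mem_singleton]
  constructor
  · rintro ⟨⟨k, hk, hx⟩, h⟩
    refine ⟨k, hk, ?_⟩
    have h' := fun h' => h ⟨⟨k, hk, hx⟩, k, hk, hx, h'⟩
    rw [mem_Lam] at hx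
    rw [linSet, Finset.mem_filter]
    refine ⟨hx.1, hx.2.2, ?_⟩
    rcases (adj_univ _ _).1 hx.2.1 with H | H
    · exact H
    · exact absurd (by omega) h'
  · rintro ⟨k, hk, hx⟩
    refine ⟨⟨k, hk, linSet_subset_Lam hx⟩, ?_⟩
    rintro ⟨-, l, hl, hxl, h⟩
    obtain rfl := Lam_unique (Finset.mem_Icc.1 hk).1 (Finset.mem_Icc.1 hl).1
      (linSet_subset_Lam hx) hxl
    rw [linSet, Finset.mem_filter] at hx
    have := hx.2.2
    unfold LinAdj at this
    omega

lemma card_LamU_sdiff_Pi' {n r : ℕ} (hr : 4 ≤ r) (hn : r < n) :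
    ((LamU n r \ Pi' n r).card : ℝ) / n.factorial =
      2 * ((r : ℝ) - 3) * (n - r) / (n * (n - 2)) := by
  obtain ⟨m, rfl⟩ : ∃ m, n = m + 1 := ⟨n - 1, by omega⟩
  rw [LamU_sdiff_Pi' (by omega), Finset.card_biUnion]
  · have htel : ∀ j, r ≤ j + 1 → j ≤ m →
        ∑ k ∈ Finset.Icc r j, ((linSet (m + 1) r k).card : ℝ) / (m + 1).factorial =
          2 / ((m : ℝ) + 1) * (((r : ℝ) - 2) * (r - 3) * (1 / ((r : ℝ) - 2) - 1 / (j - 1))) := by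
      intro j hj
      have hj' : r - 1 ≤ j := by omega
      clear hj
      induction j, hj' using Nat.le_induction with
      | base =>
        intro _
        rw [Finset.Icc_eq_empty (by omega), Nat.cast_sub (by omega)]
        push_cast
        rw [show (r : ℝ) - 1 - 1 = r - 2 by ring]
        simp
      | succ j hj ih =>
        intro hjm
        rw [← Finset.insert_Icc_right_eq_Icc_add_one (by omega), Finset.sum_insert (by simp),
          ih (by omega), card_linSet hjm, card_nonAdjSet hr (by omega)]
        push_cast
        ring
    push_cast
    rw [Finset.sum_div, htel m (by omega) le_rfl]
    have h1 : (r : ℝ) - 2 ≠ 0 := by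
      have : (4 : ℝ) ≤ r := by exact_mod_cast hr
      linarith
    have h2 : (m : ℝ) - 1 ≠ 0 := by
      have : (4 : ℝ) ≤ m := by exact_mod_cast (by omega : 4 ≤ m)
      linarith
    have h3 : (m : ℝ) + 1 - 2 ≠ 0 := by rwa [show (m : ℝ) + 1 - 2 = m - 1 by ring]
    field_simp
    ring
  · intro k hk l hl hkl
    rw [Function.onFun, Finset.disjoint_left]
    intro x hxk hxl
    rw [Finset.coe_Icc, Set.mem_Icc] at hk hl
    exact hkl (Lam_unique hk.1 hl.1 (linSet_subset_Lam hxk) (linSet_subset_Lam hxl))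

lemma tendsto_card_LamU_sdiff_Pi' {α : ℝ} (h0 : 0 < α) (h1 : α < 1) :
    Filter.Tendsto (fun n : ℕ =>
        ((LamU n ⌊α * n⌋₊ \ Pi' n ⌊α * n⌋₊).card : ℝ) / (Nat.factorial n : ℝ))
      Filter.atTop (nhds (2 * α * (1 - α))) := by
  have hr : Filter.Tendsto (fun n : ℕ => (⌊α * n⌋₊ : ℝ) / n) Filter.atTop (nhds α) :=
    (tendsto_nat_floor_mul_div_atTop h0.le).comp tendsto_natCast_atTop_atTop
  have hc : ∀ c : ℝ, Filter.Tendsto (fun n : ℕ => c / (n : ℝ)) Filter.atTop (nhds 0) :=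
    fun c => tendsto_const_div_atTop_nhds_zero_nat c
  have hlim : Filter.Tendsto (fun n : ℕ => 2 * ((⌊α * n⌋₊ : ℝ) / n - 3 / n) *
      (1 - (⌊α * n⌋₊ : ℝ) / n) / (1 - 2 / n)) Filter.atTop
      (nhds (2 * (α - 0) * (1 - α) / (1 - 0))) :=
    ((((hr.sub (hc 3)).const_mul 2).mul (hr.const_sub 1)).div ((hc 2).const_sub 1) (by norm_num))
  rw [sub_zero, sub_zero, div_one] at hlim
  refine hlim.congr' ?_
  have hfloor : Filter.Tendsto (fun n : ℕ => ⌊α * n⌋₊) Filter.atTop Filter.atTop :=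
    tendsto_nat_floor_atTop.comp (tendsto_natCast_atTop_atTop.const_mul_atTop h0)
  filter_upwards [hfloor.eventually_ge_atTop 4, Filter.eventually_gt_atTop 2] with n h4 hn
  have hn' : (2 : ℝ) < n := by exact_mod_cast hn
  rw [card_LamU_sdiff_Pi' h4 ((Nat.floor_lt (by positivity)).2 (by nlinarith))]
  have : (n : ℝ) - 2 ≠ 0 := by linarith
  have : (n : ℝ) ≠ 0 := by linarith
  field_simp

/-- for real `0 < α < 1`, the limit of
`|Λ_n(⌊αn⌋) \ Π_n(⌊αn⌋)| / n!` exists, is at most `1/2`, and for `α = 1/2`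
the corresponding limit equals exactly `1/2`. -/
theorem statement0 (α : ℝ) (h0 : 0 < α) (h1 : α < 1) :
    ∃ L : ℝ,
      Filter.Tendsto (fun n : ℕ =>
          ((LamU n ⌊α * n⌋₊ \ Pi' n ⌊α * n⌋₊).card : ℝ) / (Nat.factorial n : ℝ))
        Filter.atTop (nhds L) ∧
      L ≤ 1 / 2 ∧
      Filter.Tendsto (fun n : ℕ =>
          ((LamU n ⌊(1 / 2 : ℝ) * n⌋₊ \ Pi' n ⌊(1 / 2 : ℝ) * n⌋₊).card : ℝ) /
            (Nat.factorial n : ℝ))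
        Filter.atTop (nhds (1 / 2)) := by
  refine ⟨2 * α * (1 - α), tendsto_card_LamU_sdiff_Pi' h0 h1, ?_, ?_⟩
  · nlinarith [sq_nonneg (2 * α - 1)]
  · convert tendsto_card_LamU_sdiff_Pi' (α := 1 / 2) (by norm_num) (by norm_num) using 2
    norm_num

end Secretary
end

section
/- If r,k ∈ {3,…,n-1} with r ≤ k, and z, z̄ ∈ C_n with {z, z̄} ∈ Adj(C_n), then (k-1)(k-2) · |Λ_n(r,k,z,z̄)| = (n-2)! · (r-2)(r-3); that is, |Λ_n(r,k,z,z̄)| = (n-2)! (r-2)(r-3) / ((k-1)(k-2)). -/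
open Finset

namespace Secretary

section RelativeRank

variable {n : ℕ} {P : Finset (Fin n)} {x y : Fin n}

lemma rr_lt_rr (hy : y ∈ P) (h : x < y) : rr P x < rr P y := by
  unfold rr
  refine Nat.cast_lt.mpr (card_lt_card ?_)
  rw [ssubset_iff_of_subset]
  · exact ⟨y, by simp [hy], by simp [h]⟩
  · intro u hu
    simp only [mem_filter] at hu ⊢
    exact ⟨hu.1, hu.2.trans h.le⟩

lemma injOn_rr (P : Finset (Fin n)) : Set.InjOn (rr P) P := by
  intro a ha b hb hab
  rcases lt_trichotomy a b with h | h | h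
  · exact absurd hab (rr_lt_rr hb h).ne
  · exact h
  · exact absurd hab (rr_lt_rr ha h).ne'

lemma rr_mem_Icc (hx : x ∈ P) : rr P x ∈ Icc (1 : ℤ) P.card := by
  have h₀ : 0 < (P.filter fun u => u ≤ x).card := card_pos.mpr ⟨x, by simp [hx]⟩
  have h₁ := card_filter_le P fun u => u ≤ x
  simp only [rr, mem_Icc]
  omega

lemma image_rr (P : Finset (Fin n)) : P.image (rr P) = Icc (1 : ℤ) P.card := by
  refine eq_of_subset_of_card_le (image_subset_iff.mpr fun _ => rr_mem_Icc) ?_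
  rw [card_image_of_injOn (injOn_rr P)]
  simp

lemma card_filter_adj (hP : 3 ≤ P.card) (hy : y ∈ P) :
    (P.filter fun u => Adj P u y).card = 2 := by
  rw [← card_image_of_injOn ((injOn_rr P).mono (coe_subset.mpr (filter_subset _ P)))]
  have key : (P.filter fun u => Adj P u y).image (rr P) =
      (Icc (1 : ℤ) P.card).filter fun a =>
        a - rr P y ∈ Δ P.card ∨ rr P y - a ∈ Δ P.card := by
    rw [← image_rr, filter_image]
    congr 1
    ext u
    rw [mem_filter, mem_filter, Adj]
    tauto
  have hb := mem_Icc.mp (rr_mem_Icc hy)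
  rw [key]
  generalize rr P y = b at *
  generalize P.card = c at *
  rw [card_eq_two]
  refine ⟨if b = 1 then c else b - 1, if b = c then 1 else b + 1, ?_, ?_⟩
  · split_ifs <;> omega
  · ext a
    simp only [mem_filter, mem_Icc, Δ, mem_insert, mem_singleton]
    split_ifs <;> omega

lemma Adj.ne (hP : 2 ≤ P.card) (h : Adj P x y) : x ≠ y := by
  rintro rfl
  have h' := h.2.2
  simp only [Δ, mem_insert, mem_singleton] at h'
  omega

lemma card_filter_ne_not_adj (hP : 3 ≤ P.card) (hy : y ∈ P) :
    (P.filter fun u => u ≠ y ∧ ¬ Adj P u y).card = P.card - 3 := by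
  have h : P.filter (fun u => u ≠ y ∧ ¬ Adj P u y) =
      (P.filter fun u => ¬ Adj P u y).erase y := by
    ext u
    simp only [mem_filter, mem_erase]
    tauto
  have hy' : y ∈ P.filter fun u => ¬ Adj P u y :=
    mem_filter.mpr ⟨hy, fun h => h.ne (by omega) rfl⟩
  have hc := card_filter_add_card_filter_not (s := P) (fun u => Adj P u y)
  rw [card_filter_adj hP hy] at hc
  rw [h, card_erase_of_mem hy']
  omega

end RelativeRank

lemma card_perm_apply_eq_apply_eq {α : Type*} [Fintype α] [DecidableEq α] {a b z w : α}
    (hab : a ≠ b) (hzw : z ≠ w) :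
    (univ.filter fun e : Equiv.Perm α => e a = z ∧ e b = w).card =
      (Fintype.card α - 2).factorial := by
  obtain ⟨f, hfa, hfb⟩ : ∃ f : Equiv.Perm α, f a = z ∧ f b = w := by
    have hb : z ≠ Equiv.swap a z b := fun h => hab <| by
      simpa using congrArg (Equiv.swap a z) h
    exact ⟨Equiv.swap (Equiv.swap a z b) w * Equiv.swap a z,
      by simp [Equiv.swap_apply_of_ne_of_ne hb hzw], by simp⟩
  have e₁ : {e : Equiv.Perm α // e a = z ∧ e b = w} ≃
      {e : Equiv.Perm α // ∀ c, ¬ (c ≠ a ∧ c ≠ b) → e c = c} := by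
    refine (Equiv.mulLeft f⁻¹).subtypeEquiv fun e => ?_
    constructor
    · rintro ⟨ha, hb⟩ c hc
      have : c = a ∨ c = b := by tauto
      rcases this with rfl | rfl
      · simp [ha, ← hfa]
      · simp [hb, ← hfb]
    · intro h
      have ha := h a (by tauto)
      have hb := h b (by tauto)
      simp only [Equiv.coe_mulLeft, Equiv.Perm.mul_apply, Equiv.Perm.inv_eq_iff_eq] at ha hb
      exact ⟨ha.trans hfa, hb.trans hfb⟩
  have hc : Fintype.card {c : α // c ≠ a ∧ c ≠ b} = Fintype.card α - 2 := by
    rw [Fintype.card_subtype]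
    have : (univ.filter fun c : α => c ≠ a ∧ c ≠ b) = univ \ {a, b} := by
      ext c
      simp
    rw [this, card_sdiff_of_subset (subset_univ _), card_pair hab, card_univ]
  rw [← Fintype.card_subtype, Fintype.card_congr e₁,
    Fintype.card_congr (Equiv.Perm.subtypeEquivSubtypePerm fun c => c ≠ a ∧ c ≠ b).symm,
    Fintype.card_perm, hc]

lemma card_injective_apply_eq_apply_eq {α : Type*} [Fintype α] [DecidableEq α] {a b z w : α}
    (hab : a ≠ b) (hzw : z ≠ w) :
    (univ.filter fun x : α → α => Function.Injective x ∧ x a = z ∧ x b = w).card =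
      (Fintype.card α - 2).factorial := by
  classical
  rw [← card_perm_apply_eq_apply_eq hab hzw]
  symm
  refine card_bij (fun e _ => ⇑e) ?_ ?_ ?_
  · intro e he
    exact mem_filter.mpr ⟨mem_univ _, e.injective, (mem_filter.mp he).2⟩
  · intro e _ e' _ h
    exact DFunLike.coe_injective h
  · intro x hx
    obtain ⟨hinj, h⟩ := (mem_filter.mp hx).2
    exact ⟨Equiv.ofBijective x (Finite.injective_iff_bijective.mp hinj),
      mem_filter.mpr ⟨mem_univ _, h⟩, rfl⟩

section Arrangements

variable {n : ℕ}

lemma pre_comp_swap (x : Fin n → Fin n) {p q : Fin n} {j : ℕ}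
    (hp : (p : ℕ) < j) (hq : (q : ℕ) < j) : pre (x ∘ Equiv.swap p q) j = pre x j := by
  have h : (univ.filter fun t : Fin n => (t : ℕ) < j).image (Equiv.swap p q) =
      univ.filter fun t : Fin n => (t : ℕ) < j := by
    refine eq_of_subset_of_card_le (image_subset_iff.mpr fun t ht => ?_) ?_
    · simp only [mem_filter, mem_univ, true_and] at ht ⊢
      rw [Equiv.swap_apply_def]
      split_ifs <;> assumption
    · rw [card_image_of_injective _ (Equiv.injective _)]
  rw [pre, ← image_image, h, pre]

lemma card_pre {x : Fin n → Fin n} (hx : Function.Injective x) {j : ℕ} (hj : j ≤ n) :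
    (pre x j).card = j := by
  rw [pre, card_image_of_injective _ hx, Fin.card_filter_val_lt, min_eq_right hj]

variable [NeZero n]

lemma get_eq (x : Fin n → Fin n) {j : ℕ} (hj : j - 1 < n) : get x j = x ⟨j - 1, hj⟩ := by
  simp only [get, Nat.mod_eq_of_lt hj]

lemma get_comp_swap (x : Fin n → Fin n) {p q : Fin n} {j : ℕ} (hj : j - 1 < n)
    (hp : (p : ℕ) < j - 1) (hq : (q : ℕ) < j - 1) :
    get (x ∘ Equiv.swap p q) j = get x j := by
  rw [get_eq _ hj, get_eq _ hj, Function.comp_apply, Equiv.swap_apply_of_ne_of_ne] <;>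
    · rw [ne_eq, Fin.ext_iff]
      exact ne_of_gt ‹_›

/-- Arrangements with `x_k = z` and `x_{k+1} = w` in which no two consecutive applicants
`x_{i-1}, x_i` with `r ≤ i ≤ k` are adjacent. -/
def arrangements (k : ℕ) (z w : Fin n) (r : ℕ) : Finset (Fin n → Fin n) :=
  univ.filter fun x => Function.Injective x ∧ (get x k = z ∧ get x (k + 1) = w) ∧
    ∀ i, i ≤ k → r ≤ i → ¬ Adj (pre x i) (get x (i - 1)) (get x i)

variable {k r : ℕ} {z w : Fin n}

lemma comp_swap_mem_arrangements {x : Fin n → Fin n} (hk : k < n) (hrk : r < k + 1)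
    {p q : Fin n} (hp : (p : ℕ) < r - 1) (hq : (q : ℕ) < r - 1)
    (hx : x ∈ arrangements k z w (r + 1)) :
    x ∘ Equiv.swap p q ∈ arrangements k z w (r + 1) := by
  simp only [arrangements, mem_filter, mem_univ, true_and] at hx ⊢
  obtain ⟨hinj, hkz, hadj⟩ := hx
  refine ⟨hinj.comp (Equiv.injective _), ?_, fun i hik hri => ?_⟩
  · rwa [get_comp_swap x (by omega) (by omega) (by omega),
      get_comp_swap x (by omega) (by omega) (by omega)]
  · rw [pre_comp_swap x (by omega) (by omega), get_comp_swap x (by omega) (by omega) (by omega),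
      get_comp_swap x (by omega) (by omega) (by omega)]
    exact hadj i hik hri

lemma mem_arrangements_iff {x : Fin n → Fin n} (hrk : r ≤ k) :
    x ∈ arrangements k z w r ↔
      x ∈ arrangements k z w (r + 1) ∧ ¬ Adj (pre x r) (get x (r - 1)) (get x r) := by
  simp only [arrangements, mem_filter, mem_univ, true_and]
  constructor
  · rintro ⟨h₁, h₂, h₃⟩
    exact ⟨⟨h₁, h₂, fun i hi hr => h₃ i hi (by omega)⟩, h₃ r hrk le_rfl⟩
  · rintro ⟨⟨h₁, h₂, h₃⟩, h₄⟩
    refine ⟨h₁, h₂, fun i hi hr => ?_⟩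
    rcases hr.eq_or_lt with rfl | hr
    · exact h₄
    · exact h₃ i hi hr

lemma card_filter_not_adj_apply (hk : k < n) (hrk : r ≤ k) (hr : 3 ≤ r) {p : Fin n}
    (hp : (p : ℕ) < r - 1) :
    ((arrangements k z w (r + 1)).filter fun x => ¬ Adj (pre x r) (x p) (get x r)).card =
      (arrangements k z w r).card := by
  have hq : r - 1 - 1 < n := by omega
  set q : Fin n := ⟨r - 1 - 1, hq⟩ with hqdef
  have hqr : (q : ℕ) < r - 1 := by simp only [hqdef]; omega
  have hinv (x : Fin n → Fin n) : (x ∘ Equiv.swap p q) ∘ Equiv.swap p q = x := by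
    ext t
    simp
  refine card_nbij' (fun x => x ∘ Equiv.swap p q) (fun x => x ∘ Equiv.swap p q) ?_ ?_
    (fun x _ => hinv x) (fun x _ => hinv x)
  · intro x hx
    simp only [mem_coe, mem_filter] at hx
    refine mem_coe.mpr ((mem_arrangements_iff hrk).mpr
      ⟨comp_swap_mem_arrangements hk (by omega) hp hqr hx.1, ?_⟩)
    rw [pre_comp_swap x (by omega) (by omega), get_comp_swap x (by omega) hp hqr,
      get_eq _ hq, ← hqdef]
    dsimp only
    rw [Function.comp_apply, Equiv.swap_apply_right]
    exact hx.2
  · intro x hx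
    obtain ⟨hx, hadj⟩ := (mem_arrangements_iff hrk).mp (mem_coe.mp hx)
    simp only [mem_coe, mem_filter]
    refine ⟨comp_swap_mem_arrangements hk (by omega) hp hqr hx, ?_⟩
    rw [pre_comp_swap x (by omega) (by omega), get_comp_swap x (by omega) hp hqr,
      Function.comp_apply, Equiv.swap_apply_left]
    rwa [get_eq _ hq] at hadj

lemma card_filter_not_adj_position {x : Fin n → Fin n} (hx : Function.Injective x)
    (hr : 3 ≤ r) (hrn : r ≤ n) :
    ((univ.filter fun p : Fin n => (p : ℕ) < r - 1).filter
      fun p => ¬ Adj (pre x r) (x p) (get x r)).card = r - 3 := by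
  have hr' : r - 1 < n := by omega
  have hmem : get x r ∈ pre x r := by
    rw [get_eq x hr']
    exact mem_image_of_mem _ (by simp only [mem_filter, mem_univ, true_and]; omega)
  have h := card_filter_ne_not_adj (by rw [card_pre hx hrn]; exact hr) hmem
  rw [card_pre hx hrn] at h
  rw [← h, ← card_image_of_injective _ hx]
  congr 1
  ext u
  simp only [mem_image, mem_filter, mem_univ, true_and]
  simp only [pre, mem_image, mem_filter, mem_univ, true_and]
  constructor
  · rintro ⟨p, ⟨hp, hadj⟩, rfl⟩
    refine ⟨⟨p, by omega, rfl⟩, ?_, hadj⟩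
    rw [get_eq x hr', hx.ne_iff, ne_eq, Fin.ext_iff]
    exact hp.ne
  · rintro ⟨⟨p, hp, rfl⟩, hne, hadj⟩
    rw [get_eq x hr', hx.ne_iff, ne_eq, Fin.ext_iff] at hne
    simp only at hne
    exact ⟨p, ⟨by omega, hadj⟩, rfl⟩

lemma mul_card_arrangements (hk : k < n) (hrk : r ≤ k) (hr : 3 ≤ r) :
    (r - 1) * (arrangements k z w r).card = (r - 3) * (arrangements k z w (r + 1)).card := by
  have h := sum_card_bipartiteAbove_eq_sum_card_bipartiteBelow
    (s := univ.filter fun p : Fin n => (p : ℕ) < r - 1) (t := arrangements k z w (r + 1))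
    (fun p x => ¬ Adj (pre x r) (x p) (get x r))
  rw [sum_const_nat (m := (arrangements k z w r).card), sum_const_nat (m := r - 3),
    Fin.card_filter_val_lt, min_eq_right (by omega)] at h
  · rw [h, mul_comm]
  · intro x hx
    exact card_filter_not_adj_position (mem_filter.mp hx).2.1 hr (by omega)
  · intro p hp
    exact card_filter_not_adj_apply hk hrk hr (mem_filter.mp hp).2

lemma card_arrangements_succ (hk : k < n) (hk₀ : 1 ≤ k) (hzw : z ≠ w) :
    (arrangements k z w (k + 1)).card = (n - 2).factorial := by
  have hne : (⟨k - 1, by omega⟩ : Fin n) ≠ ⟨k, hk⟩ := by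
    rw [ne_eq, Fin.ext_iff]
    simp only
    omega
  have h := card_injective_apply_eq_apply_eq hne hzw
  rw [Fintype.card_fin] at h
  rw [← h, arrangements]
  congr 1
  ext x
  simp only [mem_filter, mem_univ, true_and]
  rw [get_eq x (by omega : k - 1 < n), get_eq x (by omega : k + 1 - 1 < n)]
  simp only [Nat.add_sub_cancel]
  constructor
  · exact fun h => ⟨h.1, h.2.1⟩
  · exact fun h => ⟨h.1, h.2, fun i h₁ h₂ => absurd h₁ (by omega)⟩

lemma card_arrangements (hk : k < n) (hr : 3 ≤ r) (hrk : r ≤ k + 1) (hzw : z ≠ w) :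
    (k - 1) * (k - 2) * (arrangements k z w r).card =
      (n - 2).factorial * ((r - 2) * (r - 3)) := by
  induction hrk using Nat.decreasingInduction with
  | self =>
    rw [card_arrangements_succ hk (by omega) hzw, show k + 1 - 2 = k - 1 by omega,
      show k + 1 - 3 = k - 2 by omega, mul_comm]
  | of_succ r hrk ih =>
    have ih := ih (by omega)
    have h := mul_card_arrangements (z := z) (w := w) hk (by omega : r ≤ k) hr
    rw [show r + 1 - 2 = r - 1 by omega, show r + 1 - 3 = r - 2 by omega] at ih
    refine Nat.eq_of_mul_eq_mul_left (by omega : 0 < r - 1) ?_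
    linear_combination ((k - 1) * (k - 2)) * h + (r - 3) * ih

end Arrangements

/-- if `r,k ∈ {3,…,n-1}`, `r ≤ k`, and `{z, z̄} ∈ Adj(C_n)`, then
`(k-1)(k-2) · |Λ_n(r,k,z,z̄)| = (n-2)! · (r-2)(r-3)`. -/
theorem statement3 {n : ℕ} (hn : 3 < n) (r k : ℕ)
    (hr : 3 ≤ r) (hrk : r ≤ k) (hk : k ≤ n - 1)
    (z w : Fin n) (hzw : Adj Finset.univ z w) :
    (k - 1) * (k - 2) * (Lam4 n r k z w).card =
      Nat.factorial (n - 2) * ((r - 2) * (r - 3)) := by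
  obtain _ | m := n
  · exact z.elim0
  have hne : z ≠ w := hzw.ne (by rw [card_univ, Fintype.card_fin]; omega)
  rw [← card_arrangements (by omega : k < m + 1) hr (by omega) hne]
  congr 2
  ext x
  simp only [Lam4, Lam, Ω, arrangements, mem_filter, mem_univ, true_and]
  constructor
  · rintro ⟨⟨h₁, -, h₂⟩, h₃⟩
    exact ⟨h₁, h₃, h₂⟩
  · rintro ⟨h₁, h₃, h₂⟩
    exact ⟨⟨h₁, by rwa [h₃.1, h₃.2], h₂⟩, h₃⟩
end Secretary
end
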